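/- Let $\overline{f}=\prod_{i=1}^m(x-\alpha_i)^{d_i}$ of degree $d$ and $\overline{g}=\prod_{\ell=1}^n(x-\beta_\ell)^{e_\ell}$ of degree $e$ with $1<d\le e$, all points pairwise distinct and $\alpha_i\ne\beta_\ell$. Then $\mathrm{Sres}_1(\overline{f},\overline{g})=\sum_{i=1}^m(-1)^{d-d_i}\frac{\prod_{j\ne i}\overline{g}(\alpha_j)^{d_j}}{\overline{f}_i(\alpha_i)}\overline{g}(\alpha_i)^{d_i-1}\Big((x-\alpha_i)\,S_{d_i-1}^{(i)}+\min\{1,d_i-1\}\,S_{d_i-2}^{(i)}\Big)$, where $S_k^{(i)}:=\sum_{k_1+\cdots+\widehat{k_i}+\cdots+k_{m+n}=k}\prod_{j\ne i,\,j\le m}\frac{\binom{d_j-1+k_j}{k_j}}{(\alpha_i-\alpha_j)^{k_j}}\prod_{\ell=1}^n\frac{\binom{e_\ell-1+k_{m+\ell}}{k_{m+\ell}}}{(\alpha_i-\beta_\ell)^{k_{m+\ell}}}$. -/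

import Mathlib

open Finset Polynomial

/-- The `t`-th subresultant of `f` and `g` (of formal degrees `d` and `e`), defined as
the determinant of the `(d+e-2t) × (d+e-2t)` Sylvester-type matrix whose first `e-t`
rows contain the coefficients of `f` (shifted), last column `x^{e-t-1-r} f`, and whose
last `d-t` rows contain the coefficients of `g` (shifted), last column `x^{d-t-1-r'} g`. -/
noncomputable def Sres {K : Type*} [CommRing K] (f g : Polynomial K) (d e t : ℕ) :
    Polynomial K :=
  Matrix.det (Matrix.of fun r c : Fin (d + e - 2 * t) =>
    if (r : ℕ) < e - t then
      if (c : ℕ) = d + e - 2 * t - 1 then X ^ (e - t - 1 - (r : ℕ)) * f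
      else if (c : ℕ) ≤ d + (r : ℕ) then Polynomial.C (f.coeff (d + (r : ℕ) - (c : ℕ)))
      else 0
    else
      if (c : ℕ) = d + e - 2 * t - 1 then X ^ (d - t - 1 - ((r : ℕ) - (e - t))) * g
      else if (c : ℕ) ≤ e + ((r : ℕ) - (e - t)) then
        Polynomial.C (g.coeff (e + ((r : ℕ) - (e - t)) - (c : ℕ)))
      else 0)

/-- The inner sum `S_k^{(i)}` of Theorem (Sres₁ in multiple roots): sum over tuples of
nonnegative integers indexed by `{1,…,m+n} \ {i}` summing to `k` of the products
`∏_{j≠i} binom(dⱼ-1+kⱼ, kⱼ)/(αᵢ-αⱼ)^{kⱼ} ∏_ℓ binom(e_ℓ-1+k_{m+ℓ}, k_{m+ℓ})/(αᵢ-β_ℓ)^{k_{m+ℓ}}`. -/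
noncomputable def Ssum {K : Type*} [Field K] {m n : ℕ}
    (α : Fin m → K) (β : Fin n → K) (dd : Fin m → ℕ) (ee : Fin n → ℕ)
    (i : Fin m) (k : ℕ) : K :=
  ∑ κ ∈ ((Fintype.piFinset fun _ : Fin m => Finset.range (k + 1)) ×ˢ
        (Fintype.piFinset fun _ : Fin n => Finset.range (k + 1))).filter
        (fun κ => κ.1 i = 0 ∧ (∑ j, κ.1 j) + (∑ ℓ, κ.2 ℓ) = k),
    (∏ j ∈ Finset.univ.erase i,
        ((dd j - 1 + κ.1 j).choose (κ.1 j) : K) / (α i - α j) ^ (κ.1 j)) *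
      ∏ ℓ, ((ee ℓ - 1 + κ.2 ℓ).choose (κ.2 ℓ) : K) / (α i - β ℓ) ^ (κ.2 ℓ)

set_option linter.unusedSimpArgs false

/-- The family of shifted polynomials forming the columns of the Sylvester matrix. -/
noncomputable def sylFam {K : Type*} [Field K] (f g : K[X]) (d : ℕ) (j : ℕ) : K[X] :=
  if j < d then X ^ j * g else X ^ (j - d) * f

lemma det_syl {K : Type*} [Field K] (f g : K[X]) (p q : ℕ)
    (hf : f.natDegree ≤ p + 1) (hg : g.natDegree ≤ q + 1) :
    (Matrix.of fun i j : Fin (p + q + 2) => (sylFam f g (p + 1) j).coeff i).det =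
      resultant f g (p + 1) (q + 1) := by
  have h : p + q + 2 = p + 1 + (q + 1) := by omega
  rw [resultant, ← Matrix.det_submatrix_equiv_self (finCongr h)]
  congr 1
  ext i j
  obtain ⟨i, hi⟩ := i
  obtain ⟨j, hj⟩ := j
  simp only [sylFam, sylvester, Matrix.submatrix_apply, Matrix.of_apply, finCongr_apply,
    Fin.cast_mk, Fin.addCases, Set.mem_Icc]
  by_cases hjd : j < p + 1
  · simp only [hjd, if_true, dif_pos, Fin.castLT_mk, coeff_X_pow_mul']
    by_cases h1 : j ≤ i
    · by_cases h2 : i ≤ j + (q + 1)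
      · simp [h1, h2]
      · simp only [h1, h2, if_true, and_false, if_false]
        exact coeff_eq_zero_of_natDegree_lt (by omega)
    · simp [h1]
  · simp only [hjd, if_false, dif_neg, not_false_eq_true, coeff_X_pow_mul', Fin.subNat_mk,
      Fin.cast_mk, eq_rec_constant]
    by_cases h1 : j - (p + 1) ≤ i
    · by_cases h2 : i ≤ j - (p + 1) + (p + 1)
      · simp only [h1, h2, if_true, and_true]
      · simp only [h1, h2, if_true, and_false, if_false]
        exact coeff_eq_zero_of_natDegree_lt (by omega)
    · simp [h1]

lemma sum_shift {K : Type*} [Field K] (f g a b : K[X]) (p q : ℕ)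
    (ha : a.natDegree < q + 1) (hb : b.natDegree < p + 1) :
    a * f + b * g = ∑ j : Fin (p + q + 2),
      C (if (j : ℕ) < p + 1 then b.coeff j else a.coeff (j - (p + 1))) *
        sylFam f g (p + 1) j := by
  rw [Fin.sum_univ_eq_sum_range (fun j => C (if (j : ℕ) < p + 1 then b.coeff j
      else a.coeff (j - (p + 1))) * sylFam f g (p + 1) j) (p + q + 2)]
  rw [show p + q + 2 = (p + 1) + (q + 1) by omega, Finset.sum_range_add, add_comm]
  congr 1
  · conv_lhs => rw [b.as_sum_range' _ hb, Finset.sum_mul]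
    refine Finset.sum_congr rfl fun j hj => ?_
    rw [Finset.mem_range] at hj
    simp only [sylFam, hj, if_true, ← C_mul_X_pow_eq_monomial]
    ring
  · conv_lhs => rw [a.as_sum_range' _ ha, Finset.sum_mul]
    refine Finset.sum_congr rfl fun j hj => ?_
    have h1 : ¬ (p + 1 + j < p + 1) := by omega
    simp only [sylFam, h1, if_false, ← C_mul_X_pow_eq_monomial, Nat.add_sub_cancel_left]
    ring

lemma sylFam_natDegree {K : Type*} [Field K] (f g : K[X]) (p q : ℕ)
    (hf : f.natDegree ≤ p + 1) (hg : g.natDegree ≤ q + 1) (j : ℕ) (hj : j < p + q + 2) :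
    (sylFam f g (p + 1) j).natDegree < p + q + 2 := by
  unfold sylFam
  split_ifs with h
  · refine lt_of_le_of_lt natDegree_mul_le ?_
    rw [natDegree_X_pow]; omega
  · refine lt_of_le_of_lt natDegree_mul_le ?_
    rw [natDegree_X_pow]; omega

/-- Entries of the modified Sylvester matrix: column `p` replaced by `X - x`, row `0` replaced by
the evaluation at `x`. -/
noncomputable def modFam {K : Type*} [Field K] (f g : K[X]) (p : ℕ) (x : K) (j : ℕ) : K[X] :=
  if j = p then X - C x else sylFam f g (p + 1) j

noncomputable def modEntry {K : Type*} [Field K] (f g : K[X]) (p : ℕ) (x : K) (i j : ℕ) : K :=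
  if i = 0 then (modFam f g p x j).eval x else (modFam f g p x j).coeff i

lemma det_mod {K : Type*} [Field K] (f g a b : K[X]) (p q : ℕ) (x : K)
    (hf : f.natDegree ≤ p + 1) (hg : g.natDegree ≤ q + 1)
    (ha : a.natDegree < q + 1) (hb : b.natDegree < p + 1)
    (hab : X - C x = a * f + b * g) :
    (Matrix.of fun i j : Fin (p + q + 2) => modEntry f g p x i j).det =
      b.coeff p * resultant f g (p + 1) (q + 1) := by
  rw [← det_syl f g p q hf hg]
  set M := (Matrix.of fun i j : Fin (p + q + 2) => (sylFam f g (p + 1) j).coeff i) with hM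
  have h1 := Matrix.det_updateCol_sum M ⟨p, by omega⟩
    (fun j => if (j : ℕ) < p + 1 then b.coeff j else a.coeff (j - (p + 1)))
  simp only [Nat.lt_succ_self, if_true, smul_eq_mul] at h1
  rw [← h1]
  set M' := M.updateCol ⟨p, by omega⟩ (fun k => ∑ i : Fin (p + q + 2),
    (if (i : ℕ) < p + 1 then b.coeff i else a.coeff (i - (p + 1))) * M k i) with hM'
  have hM'2 : M' = Matrix.of fun i j : Fin (p + q + 2) => (modFam f g p x j).coeff i := by
    ext i j
    rw [hM', Matrix.updateCol_apply]
    simp only [Matrix.of_apply, modFam, Fin.ext_iff]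
    split_ifs with hj
    · rw [hab, sum_shift f g a b p q ha hb]
      simp [finsetSum_coeff, hM]
    · simp [hM]
  have h2 := Matrix.det_updateRow_sum M' 0 (fun i => x ^ (i : ℕ))
  simp only [Fin.val_zero, pow_zero, one_smul] at h2
  rw [← h2]
  congr 1
  ext i j
  rw [Matrix.updateRow_apply]
  simp only [Matrix.of_apply, modEntry, Fin.ext_iff, Fin.val_zero]
  split_ifs with hi
  · rw [eval_eq_sum_range' (n := p + q + 2), ← Fin.sum_univ_eq_sum_range
      (fun i => (modFam f g p x j).coeff i * x ^ i)]
    · simp [hM'2, mul_comm]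
    · unfold modFam
      split_ifs
      · rw [natDegree_X_sub_C]; omega
      · exact sylFam_natDegree f g p q hf hg _ j.2
  · simp [hM'2]

lemma det_minor {K : Type*} [Field K] (f g : K[X]) (p q : ℕ) (x : K) (hp : 1 ≤ p) (hq : 1 ≤ q)
    (hf : f.natDegree ≤ p + 1) (hf1 : f.coeff (p + 1) = 1) (hg : g.natDegree ≤ q + 1) :
    (Matrix.of fun i j : Fin (p + q + 2) => modEntry f g p x i j).det =
      (-1) ^ (p + 1) * (Matrix.of fun i j : Fin (p + q) =>
        modEntry f g p x (if (i : ℕ) < 1 then i else i + 1) (if (j : ℕ) < p then j else j + 1)).det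
      := by
  obtain ⟨s, hs⟩ : ∃ s, p + q = s + 1 := ⟨p + q - 1, by omega⟩
  rw [hs]
  rw [Matrix.det_succ_column _ (⟨p, by omega⟩ : Fin (s + 1 + 1 + 1))]
  rw [Finset.sum_eq_single (⟨1, by omega⟩ : Fin (s + 1 + 1 + 1))]
  · have h1 : modEntry f g p x 1 p = 1 := by
      simp [modEntry, modFam, coeff_X, coeff_C]
    simp only [Matrix.of_apply, h1, mul_one]
    rw [add_comm 1 p]
    congr 1
    rw [Matrix.det_succ_row _ (Fin.last (s + 1))]
    rw [Finset.sum_eq_single (Fin.last (s + 1))]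
    · have h2 : modEntry f g p x (s + 2) (s + 2) = 1 := by
        have h3 : ¬ (s + 2 = p) := by omega
        have h4 : ¬ (s + 2 < p + 1) := by omega
        simp only [modEntry, modFam, sylFam, h3, h4, if_false]
        simp only [Nat.add_eq_zero_iff, and_false, if_false, coeff_X_pow_mul', OfNat.ofNat_ne_zero]
        rw [if_pos (by omega), show s + 2 - (s + 2 - (p + 1)) = p + 1 by omega, hf1]
      have e1 : ((⟨1, by omega⟩ : Fin (s + 1 + 1 + 1)).succAbove (Fin.last (s + 1)) : ℕ)
          = s + 2 := by
        simp [Fin.succAbove, Fin.lt_def]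
      have e2 : ((⟨p, by omega⟩ : Fin (s + 1 + 1 + 1)).succAbove (Fin.last (s + 1)) : ℕ)
          = s + 2 := by
        rw [Fin.succAbove, if_neg (by simp [Fin.lt_def]; omega)]
        simp
      simp only [Matrix.submatrix_apply, Matrix.of_apply, e1, e2, h2, mul_one]
      rw [← two_mul, pow_mul]
      simp only [even_two, Even.neg_pow, one_pow, one_mul]
      congr 1
      ext i j
      simp only [Matrix.submatrix_apply, Matrix.of_apply, Fin.succAbove_last]
      congr 1
      · simp only [Fin.succAbove, Fin.lt_def, Fin.val_castSucc]
        split_ifs <;> simp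
      · simp only [Fin.succAbove, Fin.lt_def, Fin.val_castSucc]
        split_ifs <;> simp
    · intro j _ hj
      have hj' : (j : ℕ) < s + 1 := by
        have := Fin.lt_last_iff_ne_last.2 hj
        simpa [Fin.lt_def] using this
      have e1 : ((⟨1, by omega⟩ : Fin (s + 1 + 1 + 1)).succAbove (Fin.last (s + 1)) : ℕ)
          = s + 2 := by
        simp [Fin.succAbove, Fin.lt_def]
      have e2 : ((⟨p, by omega⟩ : Fin (s + 1 + 1 + 1)).succAbove j : ℕ)
          = if (j : ℕ) < p then (j : ℕ) else j + 1 := by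
        simp only [Fin.succAbove, Fin.lt_def, Fin.val_castSucc]
        split_ifs <;> simp
      have h0 : modEntry f g p x (s + 2) (if (j : ℕ) < p then (j : ℕ) else j + 1) = 0 := by
        unfold modEntry
        rw [if_neg (by omega)]
        apply coeff_eq_zero_of_natDegree_lt
        unfold modFam
        rw [if_neg (by split_ifs <;> omega)]
        unfold sylFam
        split_ifs with c1 c2 c2
        · refine lt_of_le_of_lt natDegree_mul_le ?_
          rw [natDegree_X_pow]; omega
        · omega
        · omega
        · refine lt_of_le_of_lt natDegree_mul_le ?_
          rw [natDegree_X_pow]; omega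
      simp only [Matrix.submatrix_apply, Matrix.of_apply, e1, e2, h0, mul_zero, zero_mul]
    · simp
  · intro i _ hi
    have hi' : (i : ℕ) ≠ 1 := fun h => hi (Fin.ext h)
    have h0 : modEntry f g p x i p = 0 := by
      simp only [modEntry, modFam, if_true]
      split_ifs with h
      · simp
      · simp [coeff_X, coeff_C, h, hi'.symm]
    simp only [Matrix.of_apply, h0, mul_zero, zero_mul]
  · simp

lemma sres_eval {K : Type*} [Field K] (f g a b : K[X]) (p q : ℕ) (x : K)
    (hp : 1 ≤ p) (hq : 1 ≤ q)
    (hf : f.natDegree ≤ p + 1) (hf1 : f.coeff (p + 1) = 1) (hg : g.natDegree ≤ q + 1)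
    (ha : a.natDegree < q + 1) (hb : b.natDegree < p + 1)
    (hab : X - C x = a * f + b * g) :
    (Sres f g (p + 1) (q + 1) 1).eval x =
      (-1) ^ (p + 1) * (b.coeff p * resultant f g (p + 1) (q + 1)) := by
  rw [← det_mod f g a b p q x hf hg ha hb hab, det_minor f g p q x hp hq hf hf1 hg,
    ← mul_assoc, ← mul_pow]
  simp only [mul_neg, mul_one, neg_neg, one_pow, one_mul]
  unfold Sres
  rw [← coe_evalRingHom, RingHom.map_det, ← Matrix.det_transpose]
  have h : p + q = p + 1 + (q + 1) - 2 * 1 := by omega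
  rw [← Matrix.det_submatrix_equiv_self ((Fin.revPerm).trans (finCongr h))]
  congr 1
  ext i j
  obtain ⟨i, hi⟩ := i
  obtain ⟨j, hj⟩ := j
  have c1 : (p + q - (i + 1) = p + 1 + (q + 1) - 2 * 1 - 1) ↔ i = 0 := by omega
  have c2 : (p + q - (j + 1) < q + 1 - 1) ↔ ¬ (j < p) := by omega
  simp only [Matrix.submatrix_apply, Matrix.transpose_apply, RingHom.mapMatrix_apply,
    Matrix.map_apply, Matrix.of_apply, Equiv.trans_apply, Fin.revPerm_apply, finCongr_apply,
    Fin.val_cast, Fin.val_rev, c1, c2, coe_evalRingHom]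
  unfold modEntry modFam sylFam
  by_cases hi0 : i = 0
  · subst hi0
    by_cases hjp : j < p
    · have : j ≠ p := by omega
      have h3 : j < p + 1 := by omega
      simp only [hjp, this, h3, not_true, if_true, if_false, zero_lt_one]
      congr 3; omega
    · have h3 : j + 1 ≠ p := by omega
      have h4 : ¬ (j + 1 < p + 1) := by omega
      simp only [hjp, h3, h4, not_false_eq_true, if_true, if_false, zero_lt_one]
      congr 3; omega
  · have hi1 : ¬ (i < 1) := by omega
    have hi2 : ¬ (i + 1 = 0) := by omega
    by_cases hjp : j < p
    · have : j ≠ p := by omega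
      have h3 : j < p + 1 := by omega
      simp only [hjp, this, h3, hi0, hi1, hi2, not_true, if_true, if_false, coeff_X_pow_mul']
      by_cases hc : j ≤ i + 1
      · rw [if_pos (by omega), if_pos hc, eval_C]
        congr 1; omega
      · rw [if_neg (by omega), if_neg hc, eval_zero]
    · have h3 : j + 1 ≠ p := by omega
      have h4 : ¬ (j + 1 < p + 1) := by omega
      simp only [hjp, h3, h4, hi0, hi1, hi2, not_false_eq_true, if_true, if_false,
        coeff_X_pow_mul']
      by_cases hc : j + 1 - (p + 1) ≤ i + 1
      · rw [if_pos (by omega), if_pos hc, eval_C]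
        congr 1; omega
      · rw [if_neg (by omega), if_neg hc, eval_zero]

/-- The series `∑ binom(k-1+n, n) (t/c)^n`. -/
noncomputable def hser {K : Type*} [Field K] (c : K) (k : ℕ) : PowerSeries K :=
  PowerSeries.mk fun n => ((k - 1 + n).choose n : K) / c ^ n

lemma hser_mul {K : Type*} [Field K] (c : K) (hc : c ≠ 0) (k : ℕ) (hk : 1 ≤ k) :
    (PowerSeries.C c - PowerSeries.X) ^ k * hser c k = PowerSeries.C (c ^ k) := by
  have h1 : hser c k = PowerSeries.rescale (c⁻¹) (PowerSeries.invOneSubPow K k).val := by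
    rw [PowerSeries.invOneSubPow_val_eq_mk_sub_one_add_choose_of_pos K k hk]
    ext n
    simp only [hser, PowerSeries.coeff_mk, PowerSeries.coeff_rescale]
    rw [Nat.choose_symm_add (a := k - 1) (b := n), div_eq_mul_inv, inv_pow, mul_comm]
  have h2 : (PowerSeries.C c - PowerSeries.X) =
      PowerSeries.C c * PowerSeries.rescale (c⁻¹) (1 - PowerSeries.X : PowerSeries K) := by
    rw [map_sub, map_one, PowerSeries.rescale_X, mul_sub, ← mul_assoc, ← map_mul,
      mul_inv_cancel₀ hc]
    simp
  have h3 : (1 - PowerSeries.X : PowerSeries K) ^ k * (PowerSeries.invOneSubPow K k).val = 1 := by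
    rw [← PowerSeries.invOneSubPow_inv_eq_one_sub_pow]
    exact Units.inv_mul _
  rw [h2, h1, mul_pow, mul_assoc, ← map_pow (PowerSeries.rescale c⁻¹), ← map_mul, h3, map_one,
    mul_one, map_pow]

lemma coeff_prod_pi {K : Type*} [Field K] {ι : Type*} [Fintype ι] [DecidableEq ι]
    (h : ι → PowerSeries K) (k : ℕ) :
    PowerSeries.coeff k (∏ j, h j) =
      ∑ κ ∈ (Fintype.piFinset fun _ : ι => Finset.range (k + 1)).filter (fun κ => ∑ j, κ j = k),
        ∏ j, PowerSeries.coeff (κ j) (h j) := by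
  rw [PowerSeries.coeff_prod]
  refine Finset.sum_bij' (fun l _ => (l : ι → ℕ)) (fun κ _ => Finsupp.equivFunOnFinite.symm κ)
    ?_ ?_ ?_ ?_ ?_
  · intro l hl
    rw [Finset.mem_finsuppAntidiag] at hl
    rw [Finset.mem_filter, Fintype.mem_piFinset]
    refine ⟨fun j => ?_, hl.1⟩
    rw [Finset.mem_range, Nat.lt_succ_iff, ← hl.1]
    exact Finset.single_le_sum (f := fun j => l j) (fun _ _ => Nat.zero_le _) (Finset.mem_univ j)
  · intro κ hκ
    rw [Finset.mem_filter] at hκ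
    rw [Finset.mem_finsuppAntidiag]
    exact ⟨by simpa using hκ.2, Finset.subset_univ _⟩
  · intro l _
    ext; simp
  · intro κ _
    ext; simp
  · intro l _
    rfl

lemma coeff_Ssum {K : Type*} [Field K] {m n : ℕ}
    (α : Fin m → K) (β : Fin n → K) (dd : Fin m → ℕ) (ee : Fin n → ℕ) (i : Fin m) (k : ℕ) :
    PowerSeries.coeff k ((∏ j ∈ Finset.univ.erase i, hser (α i - α j) (dd j)) *
      ∏ l, hser (α i - β l) (ee l)) = Ssum α β dd ee i k := by
  classical
  have h0 : (∏ j ∈ Finset.univ.erase i, hser (α i - α j) (dd j)) *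
      ∏ l, hser (α i - β l) (ee l) = ∏ s : Fin m ⊕ Fin n,
        Sum.elim (fun j => if j = i then 1 else hser (α i - α j) (dd j))
          (fun l => hser (α i - β l) (ee l)) s := by
    rw [Fintype.prod_sum_type]
    simp only [Sum.elim_inl, Sum.elim_inr]
    congr 1
    rw [← Finset.mul_prod_erase Finset.univ _ (Finset.mem_univ i)]
    simp only [if_true, one_mul]
    refine Finset.prod_congr rfl fun j hj => ?_
    rw [if_neg (Finset.ne_of_mem_erase hj)]
  rw [h0, coeff_prod_pi, Ssum, Finset.sum_filter, Finset.sum_filter]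
  refine Finset.sum_bij' (fun κ _ => (fun j => κ (Sum.inl j), fun l => κ (Sum.inr l)))
    (fun κ _ => Sum.elim κ.1 κ.2) ?_ ?_ ?_ ?_ ?_
  · intro κ hκ
    rw [Fintype.mem_piFinset] at hκ
    rw [Finset.mem_product, Fintype.mem_piFinset, Fintype.mem_piFinset]
    exact ⟨fun j => hκ _, fun l => hκ _⟩
  · intro κ hκ
    rw [Finset.mem_product, Fintype.mem_piFinset, Fintype.mem_piFinset] at hκ
    rw [Fintype.mem_piFinset]
    rintro (j | l)
    · exact hκ.1 j
    · exact hκ.2 l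
  · intro κ _
    funext s
    cases s <;> rfl
  · intro κ _
    rfl
  · intro κ _
    simp only [Fintype.sum_sum_type, Fintype.prod_sum_type, Sum.elim_inl, Sum.elim_inr]
    by_cases hs : ∑ j, κ (Sum.inl j) + ∑ l, κ (Sum.inr l) = k
    · by_cases hi : κ (Sum.inl i) = 0
      · simp only [hs, hi, and_self, if_true]
        congr 1
        · rw [← Finset.mul_prod_erase Finset.univ _ (Finset.mem_univ i)]
          simp only [if_true, hi, PowerSeries.coeff_zero_one, one_mul]
          refine Finset.prod_congr rfl fun j hj => ?_
          rw [if_neg (Finset.ne_of_mem_erase hj)]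
          simp [hser]
        · simp [hser]
      · simp only [hs, hi, false_and, if_true, if_false]
        rw [← Finset.mul_prod_erase Finset.univ _ (Finset.mem_univ i)]
        simp [PowerSeries.coeff_one, hi]
    · simp only [hs, and_false, if_false]

/-- The local inverse power series at `α i`. -/
noncomputable def Pser {K : Type*} [Field K] {m n : ℕ}
    (α : Fin m → K) (β : Fin n → K) (dd : Fin m → ℕ) (ee : Fin n → ℕ) (i : Fin m) :
    PowerSeries K :=
  PowerSeries.mk fun k => (-1) ^ k * Ssum α β dd ee i k

lemma Pser_eq {K : Type*} [Field K] {m n : ℕ}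
    (α : Fin m → K) (β : Fin n → K) (dd : Fin m → ℕ) (ee : Fin n → ℕ) (i : Fin m) :
    Pser α β dd ee i = (∏ j ∈ Finset.univ.erase i,
        PowerSeries.rescale (-1) (hser (α i - α j) (dd j))) *
      ∏ l, PowerSeries.rescale (-1) (hser (α i - β l) (ee l)) := by
  rw [← map_prod, ← map_prod, ← map_mul]
  ext k
  rw [PowerSeries.coeff_rescale, coeff_Ssum, Pser, PowerSeries.coeff_mk]

lemma taylor_factor {K : Type*} [Field K] (a b : K) (hab : a - b ≠ 0) (k : ℕ) (hk : 1 ≤ k) :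
    ((taylor a ((X - C b) ^ k) : K[X]) : PowerSeries K) *
      PowerSeries.rescale (-1) (hser (a - b) k) = PowerSeries.C ((a - b) ^ k) := by
  have h := congrArg (PowerSeries.rescale (-1 : K)) (hser_mul (a - b) hab k hk)
  rw [map_mul, map_pow, map_sub, PowerSeries.rescale_X] at h
  have e1 : ∀ c : K, PowerSeries.rescale (-1 : K) (PowerSeries.C c) = PowerSeries.C c := by
    intro c
    ext n
    rw [PowerSeries.coeff_rescale, PowerSeries.coeff_C]
    split_ifs with hn <;> simp [hn]
  rw [e1, e1] at h
  rw [← h]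
  congr 1
  rw [taylor_pow, map_sub, taylor_X, taylor_C]
  push_cast
  congr 1
  simp only [map_sub, map_neg, map_one]
  ring

lemma Pser_mul {K : Type*} [Field K] {m n : ℕ}
    (α : Fin m → K) (β : Fin n → K) (hα : Function.Injective α) (hαβ : ∀ i l, α i ≠ β l)
    (dd : Fin m → ℕ) (ee : Fin n → ℕ) (hdd : ∀ i, 1 ≤ dd i) (hee : ∀ l, 1 ≤ ee l) (i : Fin m) :
    ((taylor (α i) ((∏ j ∈ Finset.univ.erase i, (X - C (α j)) ^ dd j) *
      ∏ l, (X - C (β l)) ^ ee l) : K[X]) : PowerSeries K) * Pser α β dd ee i =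
      PowerSeries.C ((∏ j ∈ Finset.univ.erase i, (α i - α j) ^ dd j) *
        ∏ l, (α i - β l) ^ ee l) := by
  have t : ∀ {ι : Type} (s : Finset ι) (F : ι → K[X]),
      ((taylor (α i) (∏ j ∈ s, F j) : K[X]) : PowerSeries K) =
        ∏ j ∈ s, ((taylor (α i) (F j) : K[X]) : PowerSeries K) := by
    intro ι s F
    have := map_prod ((Polynomial.coeToPowerSeries.ringHom (R := K)).comp
      (taylorAlgHom (α i)).toRingHom) F s
    exact this
  rw [Pser_eq, taylor_mul, Polynomial.coe_mul, t, t, mul_mul_mul_comm, ← Finset.prod_mul_distrib,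
    ← Finset.prod_mul_distrib, map_mul, map_prod, map_prod]
  congr 1
  · refine Finset.prod_congr rfl fun j hj => ?_
    exact taylor_factor _ _ (sub_ne_zero.2 fun h => Finset.ne_of_mem_erase hj (hα h).symm) _ (hdd j)
  · refine Finset.prod_congr rfl fun l _ => ?_
    exact taylor_factor _ _ (sub_ne_zero.2 (hαβ i l)) _ (hee l)

/-- Local Hermite interpolation piece. -/
lemma local_piece {K : Type*} [Field K] (H : K[X]) (a x w : K) (hw : w ≠ 0)
    (P : PowerSeries K) (k : ℕ)
    (hP : ((taylor a H : K[X]) : PowerSeries K) * P = PowerSeries.C w) :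
    ∃ B : K[X], B.natDegree ≤ k ∧
      B.coeff k = PowerSeries.coeff k ((PowerSeries.X - PowerSeries.C (x - a)) * P) / w ∧
      (X - C a) ^ (k + 1) ∣ H * B - (X - C x) := by
  set Q : PowerSeries K := PowerSeries.C w⁻¹ * ((PowerSeries.X - PowerSeries.C (x - a)) * P)
    with hQ
  set T : K[X] := PowerSeries.trunc (k + 1) Q with hT
  have hTd : T.natDegree ≤ k := Nat.lt_succ_iff.1 (PowerSeries.natDegree_trunc_lt Q k)
  have hTc : T.coeff k = PowerSeries.coeff k Q := by
    rw [hT, PowerSeries.coeff_trunc, if_pos (Nat.lt_succ_self k)]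
  refine ⟨taylor (-a) T, ?_, ?_, ?_⟩
  · rw [natDegree_taylor]; exact hTd
  · have h1 : (taylor (-a) T).coeff k = T.coeff k := by
      rcases hTd.lt_or_eq with h | h
      · rw [coeff_eq_zero_of_natDegree_lt h, coeff_eq_zero_of_natDegree_lt
          (by rwa [natDegree_taylor])]
      · have := coeff_taylor_natDegree (-a) T
        rw [h] at this
        rw [this, leadingCoeff, h]
    rw [h1, hTc, hQ, PowerSeries.coeff_C_mul, div_eq_inv_mul]
  · have h2 : X ^ (k + 1) ∣ taylor a (H * taylor (-a) T - (X - C x)) := by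
      rw [X_pow_dvd_iff]
      intro n hn
      rw [map_sub, taylor_mul, taylor_taylor, add_neg_cancel, taylor_zero, map_sub, taylor_X,
        taylor_C]
      have h3 : (taylor a H * T).coeff n =
          PowerSeries.coeff n (((taylor a H : K[X]) : PowerSeries K) * Q) := by
        rw [← Polynomial.coeff_coe, Polynomial.coe_mul, PowerSeries.coeff_mul,
          PowerSeries.coeff_mul]
        refine Finset.sum_congr rfl fun ij hij => ?_
        rw [HasAntidiagonal.mem_antidiagonal] at hij
        congr 1
        rw [Polynomial.coeff_coe, hT, PowerSeries.coeff_trunc, if_pos (by omega)]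
      have h4 : ((taylor a H : K[X]) : PowerSeries K) * Q =
          ((X + C a - C x : K[X]) : PowerSeries K) := by
        have : ((taylor a H : K[X]) : PowerSeries K) * Q = PowerSeries.C w⁻¹ *
            (((taylor a H : K[X]) : PowerSeries K) * P) *
              (PowerSeries.X - PowerSeries.C (x - a)) := by
          rw [hQ]; ring
        rw [this, hP, ← map_mul, inv_mul_cancel₀ hw]
        push_cast
        simp only [map_sub, map_one]
        ring
      rw [coeff_sub, h3, h4, Polynomial.coeff_coe, sub_self]
    obtain ⟨r, hr⟩ := h2
    refine ⟨taylor (-a) r, ?_⟩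
    have h5 := congrArg (taylor (-a)) hr
    rw [taylor_taylor, neg_add_cancel, taylor_zero, taylor_mul, taylor_pow, taylor_X] at h5
    rw [h5, C_neg, sub_eq_add_neg]

lemma erase_natDegree {K : Type*} [Field K] {m : ℕ} (α : Fin m → K) (dd : Fin m → ℕ)
    (s : Finset (Fin m)) :
    (∏ j ∈ s, (X - C (α j)) ^ dd j).Monic ∧
    (∏ j ∈ s, (X - C (α j)) ^ dd j).natDegree = ∑ j ∈ s, dd j := by
  refine ⟨monic_prod_of_monic _ _ fun j _ => (monic_X_sub_C _).pow _, ?_⟩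
  rw [natDegree_prod_of_monic _ _ fun j _ => (monic_X_sub_C _).pow _]
  refine Finset.sum_congr rfl fun j _ => ?_
  rw [natDegree_pow, natDegree_X_sub_C, mul_one]

lemma exists_bezout {K : Type*} [Field K] {m n : ℕ}
    (α : Fin m → K) (β : Fin n → K) (hα : Function.Injective α) (hαβ : ∀ i l, α i ≠ β l)
    (dd : Fin m → ℕ) (ee : Fin n → ℕ) (hdd : ∀ i, 1 ≤ dd i) (hee : ∀ l, 1 ≤ ee l)
    (p q : ℕ) (hp : p + 1 = ∑ i, dd i) (hq : q + 1 = ∑ l, ee l) (x : K) :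
    ∃ a b : K[X], a.natDegree < q + 1 ∧ b.natDegree < p + 1 ∧
      X - C x = a * (∏ i, (X - C (α i)) ^ dd i) + b * (∏ l, (X - C (β l)) ^ ee l) ∧
      b.coeff p = ∑ i, PowerSeries.coeff (dd i - 1)
        ((PowerSeries.X - PowerSeries.C (x - α i)) * Pser α β dd ee i) /
          ((∏ j ∈ Finset.univ.erase i, (α i - α j) ^ dd j) * ∏ l, (α i - β l) ^ ee l) := by
  set g := ∏ l, (X - C (β l)) ^ ee l with hg
  set F : Fin m → K[X] := fun i => ∏ j ∈ Finset.univ.erase i, (X - C (α j)) ^ dd j with hF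
  have hsum : ∀ i, ∑ j ∈ Finset.univ.erase i, dd j + (dd i - 1) = p := by
    intro i
    have h1 := Finset.sum_erase_add Finset.univ dd (Finset.mem_univ i)
    have h2 := hdd i
    omega
  have hloc := fun i => local_piece (F i * g) (α i) x
    ((∏ j ∈ Finset.univ.erase i, (α i - α j) ^ dd j) * ∏ l, (α i - β l) ^ ee l)
    (mul_ne_zero (Finset.prod_ne_zero_iff.2 fun j hj => pow_ne_zero _
        (sub_ne_zero.2 fun h => Finset.ne_of_mem_erase hj (hα h).symm))
      (Finset.prod_ne_zero_iff.2 fun l _ => pow_ne_zero _ (sub_ne_zero.2 (hαβ i l))))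
    (Pser α β dd ee i) (dd i - 1) (Pser_mul α β hα hαβ dd ee hdd hee i)
  choose B hB1 hB2 hB3 using hloc
  have hgd := erase_natDegree β ee Finset.univ
  have hfd := erase_natDegree α dd Finset.univ
  rw [← hg] at hgd
  set b : K[X] := ∑ i, F i * B i with hb
  have hbd : b.natDegree ≤ p := by
    refine natDegree_sum_le_of_forall_le _ _ fun i _ => ?_
    refine natDegree_mul_le.trans ?_
    have := (erase_natDegree α dd (Finset.univ.erase i)).2
    have h3 := hsum i
    have h4 := hB1 i
    simp only [hF]
    omega
  have hdvd : (∏ i, (X - C (α i)) ^ dd i) ∣ b * g - (X - C x) := by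
    refine Finset.prod_dvd_of_coprime ?_ ?_
    · intro i _ j _ hij
      exact (isCoprime_X_sub_C_of_isUnit_sub
        (sub_ne_zero.2 fun h => hij (hα h)).isUnit).pow
    · intro i _
      have h1 : b * g - (X - C x) = (F i * g * B i - (X - C x)) +
          ∑ j ∈ Finset.univ.erase i, F j * B j * g := by
        rw [hb, ← Finset.add_sum_erase _ _ (Finset.mem_univ i), add_mul, Finset.sum_mul]
        ring
      rw [h1]
      refine dvd_add ?_ (Finset.dvd_sum fun j hj => ?_)
      · have := hB3 i
        rwa [Nat.sub_add_cancel (hdd i)] at this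
      · rw [mul_assoc]
        refine Dvd.dvd.mul_right ?_ _
        exact Finset.dvd_prod_of_mem (fun j => (X - C (α j)) ^ dd j)
          (Finset.mem_erase.2 ⟨(Finset.ne_of_mem_erase hj).symm, Finset.mem_univ i⟩)
  obtain ⟨c, hc⟩ := hdvd
  refine ⟨-c, b, ?_, Nat.lt_succ_of_le hbd, ?_, ?_⟩
  · rw [natDegree_neg]
    by_cases hc0 : c = 0
    · rw [hc0, natDegree_zero]; omega
    · have h1 : (b * g - (X - C x)).natDegree ≤ p + (q + 1) := by
        refine (natDegree_sub_le _ _).trans (max_le ?_ ?_)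
        · refine natDegree_mul_le.trans ?_
          omega
        · rw [natDegree_X_sub_C]; omega
      rw [hc, hfd.1.natDegree_mul' hc0] at h1
      omega
  · linear_combination -hc
  · rw [hb, finsetSum_coeff]
    refine Finset.sum_congr rfl fun i _ => ?_
    have h1 := erase_natDegree α dd (Finset.univ.erase i)
    rw [← hB2 i, ← hsum i, coeff_mul_add_eq_of_natDegree_le h1.2.le (hB1 i)]
    have h2 : (F i).coeff (∑ j ∈ Finset.univ.erase i, dd j) = 1 := by
      have := h1.1.coeff_natDegree
      rwa [h1.2] at this
    rw [h2, one_mul]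

lemma res_prod {K : Type*} [Field K] {m : ℕ} (α : Fin m → K) (dd : Fin m → ℕ) (g : K[X])
    (d e : ℕ) (hd : d = ∑ i, dd i) (he : g.natDegree ≤ e) :
    resultant (∏ i, (X - C (α i)) ^ dd i) g d e = ∏ i, (g.eval (α i)) ^ dd i := by
  have h := erase_natDegree α dd Finset.univ
  have h1 := resultant_prod_left Finset.univ (fun i => (X - C (α i)) ^ dd i) g e (by simp) he
  rw [h.2, ← hd] at h1
  rw [h1]
  refine Finset.prod_congr rfl fun i _ => ?_
  rw [natDegree_pow, natDegree_X_sub_C, mul_one, resultant_X_sub_C_pow_left _ _ _ _ he]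

/-- The formula in roots for `Sres₁(f̄, ḡ)` in the multiple-roots case. -/
theorem sres_one_multiple_roots {K : Type*} [Field K] [CharZero K] {m n : ℕ}
    (α : Fin m → K) (β : Fin n → K)
    (hα : Function.Injective α) (hβ : Function.Injective β)
    (hαβ : ∀ i ℓ, α i ≠ β ℓ)
    (dd : Fin m → ℕ) (ee : Fin n → ℕ) (hdd : ∀ i, 1 ≤ dd i) (hee : ∀ ℓ, 1 ≤ ee ℓ)
    (d e : ℕ) (hd : d = ∑ i, dd i) (he : e = ∑ ℓ, ee ℓ)
    (hd1 : 1 < d) (hde : d ≤ e) :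
    Sres (∏ i, (X - Polynomial.C (α i)) ^ (dd i))
        (∏ ℓ, (X - Polynomial.C (β ℓ)) ^ (ee ℓ)) d e 1 =
      ∑ i, Polynomial.C
          ((-1 : K) ^ (d - dd i) *
            ((∏ j ∈ Finset.univ.erase i,
                (Polynomial.eval (α j) (∏ ℓ, (X - Polynomial.C (β ℓ)) ^ (ee ℓ))) ^ (dd j)) /
              ∏ j ∈ Finset.univ.erase i, (α i - α j) ^ (dd j)) *
            (Polynomial.eval (α i) (∏ ℓ, (X - Polynomial.C (β ℓ)) ^ (ee ℓ))) ^ (dd i - 1)) *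
        ((X - Polynomial.C (α i)) * Polynomial.C (Ssum α β dd ee i (dd i - 1)) +
          Polynomial.C (((min 1 (dd i - 1) : ℕ) : K) * Ssum α β dd ee i (dd i - 2))) := by
  classical
  obtain ⟨p, rfl⟩ : ∃ p, d = p + 1 := ⟨d - 1, by omega⟩
  obtain ⟨q, rfl⟩ : ∃ q, e = q + 1 := ⟨e - 1, by omega⟩
  have hfd := erase_natDegree α dd Finset.univ
  have hgd := erase_natDegree β ee Finset.univ
  refine Polynomial.funext fun x => ?_
  obtain ⟨a, b, ha, hb, hab, hbc⟩ := exists_bezout α β hα hαβ dd ee hdd hee p q hd he x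
  have hf1 : (∏ i, (X - Polynomial.C (α i)) ^ (dd i)).coeff (p + 1) = 1 := by
    have := hfd.1.coeff_natDegree
    rwa [hfd.2, ← hd] at this
  rw [sres_eval _ _ a b p q x (by omega) (by omega) (by omega) hf1 (by omega) ha hb hab, hbc,
    res_prod α dd _ (p + 1) (q + 1) hd (by omega), eval_finsetSum, Finset.sum_mul, Finset.mul_sum]
  refine Finset.sum_congr rfl fun i _ => ?_
  have hev : Polynomial.eval (α i) (∏ ℓ, (X - Polynomial.C (β ℓ)) ^ (ee ℓ)) =
      ∏ ℓ, (α i - β ℓ) ^ ee ℓ := by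
    simp [eval_prod]
  rw [← Finset.mul_prod_erase Finset.univ _ (Finset.mem_univ i), hev]
  have hG : ∏ ℓ, (α i - β ℓ) ^ ee ℓ ≠ 0 :=
    Finset.prod_ne_zero_iff.2 fun l _ => pow_ne_zero _ (sub_ne_zero.2 (hαβ i l))
  have hFi : ∏ j ∈ Finset.univ.erase i, (α i - α j) ^ dd j ≠ 0 :=
    Finset.prod_ne_zero_iff.2 fun j hj => pow_ne_zero _
      (sub_ne_zero.2 fun h => Finset.ne_of_mem_erase hj (hα h).symm)
  have hle : dd i ≤ p + 1 := by
    rw [hd]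
    exact Finset.single_le_sum (f := dd) (fun _ _ => Nat.zero_le _) (Finset.mem_univ i)
  simp only [eval_mul, eval_add, eval_sub, eval_C, eval_X]
  generalize ∏ ℓ, (α i - β ℓ) ^ ee ℓ = G at *
  generalize ∏ j ∈ Finset.univ.erase i, (α i - α j) ^ dd j = Fi at *
  generalize ∏ j ∈ Finset.univ.erase i,
    (Polynomial.eval (α j) (∏ ℓ, (X - Polynomial.C (β ℓ)) ^ (ee ℓ))) ^ (dd j) = R
  obtain ⟨k, hk⟩ : ∃ k, dd i = k + 1 := ⟨dd i - 1, by have := hdd i; omega⟩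
  rw [hk] at hle ⊢
  obtain ⟨r, hr⟩ : ∃ r, p + 1 = r + (k + 1) := ⟨p + 1 - (k + 1), by omega⟩
  rw [hr, Nat.add_sub_cancel, Nat.add_sub_cancel]
  cases k with
  | zero =>
    rw [sub_mul, map_sub, PowerSeries.coeff_zero_X_mul, PowerSeries.coeff_C_mul]
    simp only [Pser, PowerSeries.coeff_mk, pow_add, pow_one, pow_zero, zero_add, one_mul,
      Nat.min_zero, Nat.cast_zero, zero_mul, add_zero, mul_one, zero_sub]
    field_simp
    try ring
  | succ k =>
    rw [sub_mul, map_sub, PowerSeries.coeff_succ_X_mul, PowerSeries.coeff_C_mul]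
    simp only [Pser, PowerSeries.coeff_mk]
    rw [show k + 1 + 1 - 2 = k by omega, show min 1 (k + 1) = 1 by omega]
    have hs : ((-1 : K) ^ k) * (-1) ^ k = 1 := by
      rw [← mul_pow]; simp
    simp only [pow_add, pow_one, Nat.cast_one, one_mul]
    field_simp
    linear_combination (R * (Ssum α β dd ee i k +
      (x - α i) * Ssum α β dd ee i (k + 1))) * hs
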